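/- arXiv:2206.10560 — 5 statements merged into one kernel-verified Lean document; each statement's English description precedes it below -/
import Mathlib

section
/- Let A₁, B₁, A₂, B₂ be types. The induced subdigraph of K(A₁,B₁) ⊗ K(A₂,B₂) on the vertex set ζ is isomorphic to the directed complete bipartite digraph K(A₁ × A₂, B₁ × B₂); explicitly, the bijection sending (a₁,a₂) : A₁ × A₂ to (Sum.inl a₁, Sum.inl a₂) and (b₁,b₂) : B₁ × B₂ to (Sum.inr b₁, Sum.inr b₂) preserves and reflects adjacency. -/
/-- The directed complete bipartite digraph on `A ⊕ B`:
arcs are exactly the pairs `(Sum.inl a, Sum.inr b)`. -/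
def K (A B : Type*) : Digraph (A ⊕ B) where
  Adj u v := (∃ a, u = Sum.inl a) ∧ (∃ b, v = Sum.inr b)

/-- Tensor product of digraphs. -/
def Digraph.tensor {V₁ V₂ : Type*} (D₁ : Digraph V₁) (D₂ : Digraph V₂) :
    Digraph (V₁ × V₂) where
  Adj u v := D₁.Adj u.1 v.1 ∧ D₂.Adj u.2 v.2

/-- Cartesian product of digraphs. -/
def Digraph.cartesian {V₁ V₂ : Type*} (D₁ : Digraph V₁) (D₂ : Digraph V₂) :
    Digraph (V₁ × V₂) where
  Adj u v := (u.1 = v.1 ∧ D₂.Adj u.2 v.2) ∨ (D₁.Adj u.1 v.1 ∧ u.2 = v.2)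

/-- Induced subdigraph on a set of vertices. -/
def Digraph.induce {V : Type*} (D : Digraph V) (S : Set V) : Digraph S where
  Adj u v := D.Adj u v

/-- The set ζ of non-mixed vertices of `K(A₁,B₁) ⊗ K(A₂,B₂)`. -/
def zeta (A₁ B₁ A₂ B₂ : Type*) : Set ((A₁ ⊕ B₁) × (A₂ ⊕ B₂)) :=
  {v | (∃ a₁ a₂, v = (Sum.inl a₁, Sum.inl a₂)) ∨
       (∃ b₁ b₂, v = (Sum.inr b₁, Sum.inr b₂))}

theorem induce_zeta_iso_completeBipartite (A₁ B₁ A₂ B₂ : Type*) :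
    ∃ e : ((A₁ × A₂) ⊕ (B₁ × B₂)) ≃ (zeta A₁ B₁ A₂ B₂),
      (∀ p : A₁ × A₂,
        (e (Sum.inl p)).val = (Sum.inl p.1, Sum.inl p.2)) ∧
      (∀ q : B₁ × B₂,
        (e (Sum.inr q)).val = (Sum.inr q.1, Sum.inr q.2)) ∧
      (∀ u v, (K (A₁ × A₂) (B₁ × B₂)).Adj u v ↔
        (((K A₁ B₁).tensor (K A₂ B₂)).induce (zeta A₁ B₁ A₂ B₂)).Adj (e u) (e v)) := by
  let f : (A₁ × A₂) ⊕ (B₁ × B₂) → zeta A₁ B₁ A₂ B₂ :=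
    Sum.elim (fun p => ⟨(Sum.inl p.1, Sum.inl p.2), Or.inl ⟨p.1, p.2, rfl⟩⟩)
      (fun q => ⟨(Sum.inr q.1, Sum.inr q.2), Or.inr ⟨q.1, q.2, rfl⟩⟩)
  have hf : Function.Bijective f := by
    constructor
    · rintro (⟨a₁, a₂⟩ | ⟨b₁, b₂⟩) (⟨a₁', a₂'⟩ | ⟨b₁', b₂'⟩) h <;>
        simpa [f] using congrArg Subtype.val h
    · rintro ⟨_, ⟨a₁, a₂, rfl⟩ | ⟨b₁, b₂, rfl⟩⟩
      · exact ⟨Sum.inl (a₁, a₂), rfl⟩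
      · exact ⟨Sum.inr (b₁, b₂), rfl⟩
  refine ⟨Equiv.ofBijective f hf, fun _ => rfl, fun _ => rfl, ?_⟩
  rintro (⟨a₁, a₂⟩ | ⟨b₁, b₂⟩) (⟨a₁', a₂'⟩ | ⟨b₁', b₂'⟩) <;>
    simp [f, K, Digraph.tensor, Digraph.induce]
end

section
/- Let X and Y be finite types with card X = c₁·c₂ and card Y = c₃·c₄, where c₁, c₂, c₃, c₄ ≥ 1. Then the directed complete bipartite digraph K(X,Y) is isomorphic to the induced subdigraph of K(Fin c₁, Fin c₃) ⊗ K(Fin c₂, Fin c₄) on the vertex set ζ. (Here K(Fin c₁, Fin c₃) is the contraction of K(X,Y) by the c₁ row-blocks of X and the c₃ row-blocks of Y, and K(Fin c₂, Fin c₄) is the contraction by the c₂ column-blocks of X and the c₄ column-blocks of Y.) -/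
/-- Pairs of left vertices and pairs of right vertices together make up `zeta`. -/
noncomputable def sumProdEquivZeta (A₁ B₁ A₂ B₂ : Type*) :
    (A₁ × A₂) ⊕ (B₁ × B₂) ≃ zeta A₁ B₁ A₂ B₂ :=
  Equiv.ofBijective
    (Sum.elim (fun p => ⟨(Sum.inl p.1, Sum.inl p.2), Or.inl ⟨p.1, p.2, rfl⟩⟩)
      (fun q => ⟨(Sum.inr q.1, Sum.inr q.2), Or.inr ⟨q.1, q.2, rfl⟩⟩)) <| by
    constructor
    · rintro (⟨a, a'⟩ | ⟨b, b'⟩) (⟨c, c'⟩ | ⟨d, d'⟩) h <;>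
        simpa using congrArg Subtype.val h
    · rintro ⟨_, ⟨a, a', rfl⟩ | ⟨b, b', rfl⟩⟩
      · exact ⟨Sum.inl (a, a'), rfl⟩
      · exact ⟨Sum.inr (b, b'), rfl⟩

@[simp]
theorem coe_sumProdEquivZeta_inl {A₁ B₁ A₂ B₂ : Type*} (p : A₁ × A₂) :
    (sumProdEquivZeta A₁ B₁ A₂ B₂ (Sum.inl p) : (A₁ ⊕ B₁) × (A₂ ⊕ B₂)) =
      (Sum.inl p.1, Sum.inl p.2) :=
  rfl

@[simp]
theorem coe_sumProdEquivZeta_inr {A₁ B₁ A₂ B₂ : Type*} (q : B₁ × B₂) :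
    (sumProdEquivZeta A₁ B₁ A₂ B₂ (Sum.inr q) : (A₁ ⊕ B₁) × (A₂ ⊕ B₂)) =
      (Sum.inr q.1, Sum.inr q.2) :=
  rfl

theorem K_adj_iff_induce_zeta_adj {X Y A₁ B₁ A₂ B₂ : Type*}
    (f : X ≃ A₁ × A₂) (g : Y ≃ B₁ × B₂) (u v : X ⊕ Y) :
    (K X Y).Adj u v ↔
      (((K A₁ B₁).tensor (K A₂ B₂)).induce (zeta A₁ B₁ A₂ B₂)).Adj
        ((f.sumCongr g).trans (sumProdEquivZeta A₁ B₁ A₂ B₂) u)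
        ((f.sumCongr g).trans (sumProdEquivZeta A₁ B₁ A₂ B₂) v) := by
  rcases u with x | y <;> rcases v with x' | y' <;>
    simp [K, Digraph.tensor, Digraph.induce]

theorem completeBipartite_iso_induce_zeta_of_card
    (X Y : Type*) [Fintype X] [Fintype Y] (c₁ c₂ c₃ c₄ : ℕ)
    (h₁ : 1 ≤ c₁) (h₂ : 1 ≤ c₂) (h₃ : 1 ≤ c₃) (h₄ : 1 ≤ c₄)
    (hX : Fintype.card X = c₁ * c₂) (hY : Fintype.card Y = c₃ * c₄) :
    ∃ e : (X ⊕ Y) ≃ (zeta (Fin c₁) (Fin c₃) (Fin c₂) (Fin c₄)),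
      ∀ u v, (K X Y).Adj u v ↔
        (((K (Fin c₁) (Fin c₃)).tensor (K (Fin c₂) (Fin c₄))).induce
          (zeta (Fin c₁) (Fin c₃) (Fin c₂) (Fin c₄))).Adj (e u) (e v) := by
  exact ⟨_, K_adj_iff_induce_zeta_adj
    (Fintype.equivOfCardEq (by simpa using hX)) (Fintype.equivOfCardEq (by simpa using hY))⟩
end

section
/- Let c₁, c₂, c₃, c₄ ≥ 1 and put D = K(Fin c₁, Fin c₃) ⊗ K(Fin c₂, Fin c₄). Then (1) the set of vertices of D that have no incoming arc in D but have an incoming arc in the Cartesian product K(Fin c₁, Fin c₃) □ K(Fin c₂, Fin c₄) is exactly the set of mixed vertices, i.e. the complement of ζ; and (2) the induced subdigraph of D on ζ (equivalently, the digraph obtained from D by deleting all these vertices together with their incident arcs) is isomorphic to the directed complete bipartite digraph K(Fin (c₁·c₂), Fin (c₃·c₄)). -/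
/-- The non-mixed vertices are the pairs of sources together with the pairs of sinks. -/
noncomputable def zetaEquiv (A₁ B₁ A₂ B₂ : Type*) :
    (A₁ × A₂) ⊕ (B₁ × B₂) ≃ zeta A₁ B₁ A₂ B₂ :=
  Equiv.ofBijective
    (Sum.elim (fun a => ⟨(Sum.inl a.1, Sum.inl a.2), Or.inl ⟨a.1, a.2, rfl⟩⟩)
      (fun b => ⟨(Sum.inr b.1, Sum.inr b.2), Or.inr ⟨b.1, b.2, rfl⟩⟩))
    ⟨by rintro (⟨a₁, a₂⟩ | ⟨b₁, b₂⟩) (⟨a₁', a₂'⟩ | ⟨b₁', b₂'⟩) h <;>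
        simpa using congrArg Subtype.val h,
      by
        rintro ⟨_, ⟨a₁, a₂, rfl⟩ | ⟨b₁, b₂, rfl⟩⟩
        · exact ⟨Sum.inl (a₁, a₂), rfl⟩
        · exact ⟨Sum.inr (b₁, b₂), rfl⟩⟩

theorem coe_zetaEquiv_inl {A₁ B₁ A₂ B₂ : Type*} (a : A₁ × A₂) :
    (zetaEquiv A₁ B₁ A₂ B₂ (Sum.inl a) : (A₁ ⊕ B₁) × (A₂ ⊕ B₂)) =
      (Sum.inl a.1, Sum.inl a.2) :=
  rfl

theorem coe_zetaEquiv_inr {A₁ B₁ A₂ B₂ : Type*} (b : B₁ × B₂) :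
    (zetaEquiv A₁ B₁ A₂ B₂ (Sum.inr b) : (A₁ ⊕ B₁) × (A₂ ⊕ B₂)) =
      (Sum.inr b.1, Sum.inr b.2) :=
  rfl

/-- Pulled back along `zetaEquiv`, the tensor product of two complete bipartite digraphs
is complete bipartite. -/
theorem tensor_K_adj_zetaEquiv {A₁ B₁ A₂ B₂ : Type*} (x y : (A₁ × A₂) ⊕ (B₁ × B₂)) :
    (((K A₁ B₁).tensor (K A₂ B₂)).induce (zeta A₁ B₁ A₂ B₂)).Adj
        (zetaEquiv A₁ B₁ A₂ B₂ x) (zetaEquiv A₁ B₁ A₂ B₂ y) ↔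
      (K (A₁ × A₂) (B₁ × B₂)).Adj x y := by
  rcases x with ⟨x₁, x₂⟩ | ⟨x₁, x₂⟩ <;> rcases y with ⟨y₁, y₂⟩ | ⟨y₁, y₂⟩ <;>
    simp [K, Digraph.tensor, Digraph.induce, coe_zetaEquiv_inl, coe_zetaEquiv_inr]

/-- Complete bipartite digraphs are invariant under bijections of their two sides. -/
theorem K_adj_sumCongr {A B A' B' : Type*} (f : A ≃ A') (g : B ≃ B') (x y : A ⊕ B) :
    (K A' B').Adj (Equiv.sumCongr f g x) (Equiv.sumCongr f g y) ↔ (K A B).Adj x y := by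
  rcases x with x | x <;> rcases y with y | y <;> simp [K]

/-- The vertices without incoming arc in the tensor product but with one in the Cartesian
product are exactly the mixed ones. -/
theorem setOf_tensor_source_cartesian_nonsource_eq_compl_zeta
    (A₁ B₁ A₂ B₂ : Type*) [Nonempty A₁] [Nonempty A₂] :
    {v : (A₁ ⊕ B₁) × (A₂ ⊕ B₂) |
        (∀ u, ¬ ((K A₁ B₁).tensor (K A₂ B₂)).Adj u v) ∧
        (∃ u, ((K A₁ B₁).cartesian (K A₂ B₂)).Adj u v)} = (zeta A₁ B₁ A₂ B₂)ᶜ := by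
  ext ⟨v | v, w | w⟩ <;> simp [K, Digraph.tensor, Digraph.cartesian, zeta]

theorem vrsp_removes_exactly_mixed_and_result_is_completeBipartite
    (c₁ c₂ c₃ c₄ : ℕ) (h₁ : 1 ≤ c₁) (h₂ : 1 ≤ c₂) (h₃ : 1 ≤ c₃) (h₄ : 1 ≤ c₄) :
    ({v : (Fin c₁ ⊕ Fin c₃) × (Fin c₂ ⊕ Fin c₄) |
        (∀ u, ¬ ((K (Fin c₁) (Fin c₃)).tensor (K (Fin c₂) (Fin c₄))).Adj u v) ∧
        (∃ u, ((K (Fin c₁) (Fin c₃)).cartesian (K (Fin c₂) (Fin c₄))).Adj u v)} =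
      (zeta (Fin c₁) (Fin c₃) (Fin c₂) (Fin c₄))ᶜ) ∧
    (∃ e : (zeta (Fin c₁) (Fin c₃) (Fin c₂) (Fin c₄)) ≃ (Fin (c₁ * c₂) ⊕ Fin (c₃ * c₄)),
      ∀ u v,
        (((K (Fin c₁) (Fin c₃)).tensor (K (Fin c₂) (Fin c₄))).induce
          (zeta (Fin c₁) (Fin c₃) (Fin c₂) (Fin c₄))).Adj u v ↔
        (K (Fin (c₁ * c₂)) (Fin (c₃ * c₄))).Adj (e u) (e v)) := by
  have : Nonempty (Fin c₁) := ⟨⟨0, h₁⟩⟩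
  have : Nonempty (Fin c₂) := ⟨⟨0, h₂⟩⟩
  refine ⟨setOf_tensor_source_cartesian_nonsource_eq_compl_zeta _ _ _ _,
    (zetaEquiv _ _ _ _).symm.trans (Equiv.sumCongr finProdFinEquiv finProdFinEquiv),
    fun u v => ?_⟩
  rw [Equiv.trans_apply, Equiv.trans_apply, K_adj_sumCongr, ← tensor_K_adj_zetaEquiv,
    Equiv.apply_symm_apply, Equiv.apply_symm_apply]
end

section
/- Fix c₁,…,c₇ ≥ 1 with c₇ ≤ c₄. The induced subdigraph of Q′ ⊗ Q″ on the set ζ of diagonal vertices is isomorphic to the 3-layer digraph T, via the bijection sending a layer-1 vertex (g,h) of T to the diagonal pair (g in layer 1 of Q′, h in layer 1 of Q″), a layer-2 vertex (i,j) of T to (i in layer 2 of Q′, j in layer 2 of Q″), and a layer-3 vertex (k,l) of T to (k in layer 3 of Q′, l in layer 3 of Q″). -/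
/-- A 3-layer digraph: all arcs from layer 1 to layer 2, and an arc from a
layer-2 vertex `b` to every layer-3 vertex whenever `mid b` holds. -/
def threeLayer (α β γ : Type*) (mid : β → Prop) : Digraph (α ⊕ β ⊕ γ) where
  Adj u v :=
    ((∃ a, u = Sum.inl a) ∧ (∃ b, v = Sum.inr (Sum.inl b))) ∨
    ((∃ b, u = Sum.inr (Sum.inl b) ∧ mid b) ∧ (∃ c, v = Sum.inr (Sum.inr c)))

/-- The row contraction Q′ : all arcs layer 1 → layer 2 and layer 2 → layer 3. -/
def Qrow (c₁ c₃ c₅ : ℕ) : Digraph (Fin c₁ ⊕ Fin c₃ ⊕ Fin c₅) :=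
  threeLayer (Fin c₁) (Fin c₃) (Fin c₅) (fun _ => True)

/-- The column contraction Q″ : all arcs layer 1 → layer 2, and arcs from the
layer-2 vertex `j` to every layer-3 vertex whenever `j < c₇`. -/
def Qcol (c₂ c₄ c₆ c₇ : ℕ) : Digraph (Fin c₂ ⊕ Fin c₄ ⊕ Fin c₆) :=
  threeLayer (Fin c₂) (Fin c₄) (Fin c₆) (fun j => (j : ℕ) < c₇)

/-- The paper's 3-partite graph `B(X,Y,Z)` with grid layers. -/
def T (c₁ c₂ c₃ c₄ c₅ c₆ c₇ : ℕ) :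
    Digraph ((Fin c₁ × Fin c₂) ⊕ (Fin c₃ × Fin c₄) ⊕ (Fin c₅ × Fin c₆)) :=
  threeLayer (Fin c₁ × Fin c₂) (Fin c₃ × Fin c₄) (Fin c₅ × Fin c₆)
    (fun p => (p.2 : ℕ) < c₇)

/-- The set ζ of diagonal vertices: both coordinates in the same layer. -/
def diag3 (α₁ β₁ γ₁ α₂ β₂ γ₂ : Type*) :
    Set ((α₁ ⊕ β₁ ⊕ γ₁) × (α₂ ⊕ β₂ ⊕ γ₂)) :=
  {v | (∃ a₁ a₂, v = (Sum.inl a₁, Sum.inl a₂)) ∨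
       (∃ b₁ b₂, v = (Sum.inr (Sum.inl b₁), Sum.inr (Sum.inl b₂))) ∨
       (∃ c₁ c₂, v = (Sum.inr (Sum.inr c₁), Sum.inr (Sum.inr c₂)))}

/-- The map sending a vertex of a 3-layer grid to the corresponding diagonal pair. -/
def toDiag {α₁ β₁ γ₁ α₂ β₂ γ₂ : Type*} :
    (α₁ × α₂) ⊕ (β₁ × β₂) ⊕ (γ₁ × γ₂) → diag3 α₁ β₁ γ₁ α₂ β₂ γ₂
  | Sum.inl p => ⟨(Sum.inl p.1, Sum.inl p.2), Or.inl ⟨_, _, rfl⟩⟩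
  | Sum.inr (Sum.inl p) =>
    ⟨(Sum.inr (Sum.inl p.1), Sum.inr (Sum.inl p.2)), Or.inr (Or.inl ⟨_, _, rfl⟩)⟩
  | Sum.inr (Sum.inr p) =>
    ⟨(Sum.inr (Sum.inr p.1), Sum.inr (Sum.inr p.2)), Or.inr (Or.inr ⟨_, _, rfl⟩)⟩

theorem toDiag_bijective {α₁ β₁ γ₁ α₂ β₂ γ₂ : Type*} :
    Function.Bijective (toDiag (α₁ := α₁) (β₁ := β₁) (γ₁ := γ₁)
      (α₂ := α₂) (β₂ := β₂) (γ₂ := γ₂)) := by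
  constructor
  · rintro (⟨a, b⟩ | ⟨a, b⟩ | ⟨a, b⟩) (⟨c, d⟩ | ⟨c, d⟩ | ⟨c, d⟩) h <;>
      simpa [toDiag] using congrArg Subtype.val h
  · rintro ⟨_, ⟨a, b, rfl⟩ | ⟨a, b, rfl⟩ | ⟨a, b, rfl⟩⟩
    · exact ⟨Sum.inl (a, b), rfl⟩
    · exact ⟨Sum.inr (Sum.inl (a, b)), rfl⟩
    · exact ⟨Sum.inr (Sum.inr (a, b)), rfl⟩

/-- The tensor product of two 3-layer digraphs, restricted to the diagonal, is the 3-layer digraph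
on the products of the layers. -/
theorem tensor_induce_adj_toDiag_iff {α₁ β₁ γ₁ α₂ β₂ γ₂ : Type*} (m₁ : β₁ → Prop) (m₂ : β₂ → Prop)
    (u v : (α₁ × α₂) ⊕ (β₁ × β₂) ⊕ (γ₁ × γ₂)) :
    (((threeLayer α₁ β₁ γ₁ m₁).tensor (threeLayer α₂ β₂ γ₂ m₂)).induce
        (diag3 α₁ β₁ γ₁ α₂ β₂ γ₂)).Adj (toDiag u) (toDiag v) ↔
      (threeLayer (α₁ × α₂) (β₁ × β₂) (γ₁ × γ₂) fun p => m₁ p.1 ∧ m₂ p.2).Adj u v := by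
  rcases u with ⟨a, b⟩ | ⟨a, b⟩ | ⟨a, b⟩ <;> rcases v with ⟨c, d⟩ | ⟨c, d⟩ | ⟨c, d⟩ <;>
    simp [toDiag, threeLayer, Digraph.tensor, Digraph.induce]

theorem induce_diag_iso_threePartite (c₁ c₂ c₃ c₄ c₅ c₆ c₇ : ℕ)
    (h₁ : 1 ≤ c₁) (h₂ : 1 ≤ c₂) (h₃ : 1 ≤ c₃) (h₄ : 1 ≤ c₄)
    (h₅ : 1 ≤ c₅) (h₆ : 1 ≤ c₆) (h₇ : 1 ≤ c₇) (h₇₄ : c₇ ≤ c₄) :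
    ∃ e : ((Fin c₁ × Fin c₂) ⊕ (Fin c₃ × Fin c₄) ⊕ (Fin c₅ × Fin c₆)) ≃
        (diag3 (Fin c₁) (Fin c₃) (Fin c₅) (Fin c₂) (Fin c₄) (Fin c₆)),
      (∀ p : Fin c₁ × Fin c₂,
        (e (Sum.inl p)).val = (Sum.inl p.1, Sum.inl p.2)) ∧
      (∀ p : Fin c₃ × Fin c₄,
        (e (Sum.inr (Sum.inl p))).val = (Sum.inr (Sum.inl p.1), Sum.inr (Sum.inl p.2))) ∧
      (∀ p : Fin c₅ × Fin c₆,
        (e (Sum.inr (Sum.inr p))).val = (Sum.inr (Sum.inr p.1), Sum.inr (Sum.inr p.2))) ∧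
      (∀ u v, (T c₁ c₂ c₃ c₄ c₅ c₆ c₇).Adj u v ↔
        (((Qrow c₁ c₃ c₅).tensor (Qcol c₂ c₄ c₆ c₇)).induce
          (diag3 (Fin c₁) (Fin c₃) (Fin c₅) (Fin c₂) (Fin c₄) (Fin c₆))).Adj (e u) (e v)) := by
  refine ⟨Equiv.ofBijective toDiag toDiag_bijective, fun _ => rfl, fun _ => rfl, fun _ => rfl,
    fun u v => ?_⟩
  simpa [T, Qrow, Qcol] using
    (tensor_induce_adj_toDiag_iff (fun _ : Fin c₃ => True) (fun j : Fin c₄ => (j : ℕ) < c₇) u v).symm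
end

section
/- Fix c₁,…,c₆ ≥ 1 and 1 ≤ c₇ ≤ c₄. A vertex v of Q′ ⊗ Q″ is diagonal if and only if either both coordinates of v lie in layer 1, or there exists a vertex with both coordinates in layer 1 from which v is reachable by a directed walk in Q′ ⊗ Q″. -/
theorem diag3_of_tensor_threeLayer_adj {α₁ β₁ γ₁ α₂ β₂ γ₂ : Type*} {mid₁ : β₁ → Prop}
    {mid₂ : β₂ → Prop} {v w : (α₁ ⊕ β₁ ⊕ γ₁) × (α₂ ⊕ β₂ ⊕ γ₂)}
    (hv : v ∈ diag3 α₁ β₁ γ₁ α₂ β₂ γ₂)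
    (h : ((threeLayer α₁ β₁ γ₁ mid₁).tensor (threeLayer α₂ β₂ γ₂ mid₂)).Adj v w) :
    w ∈ diag3 α₁ β₁ γ₁ α₂ β₂ γ₂ := by
  obtain ⟨w₁, w₂⟩ := w
  rcases hv with ⟨a₁, a₂, rfl⟩ | ⟨b₁, b₂, rfl⟩ | ⟨c₁, c₂, rfl⟩ <;>
    simp_all [Digraph.tensor, threeLayer, diag3]

theorem diagonal_iff_reachable_from_layerOne_diagonal
    (c₁ c₂ c₃ c₄ c₅ c₆ c₇ : ℕ)
    (h₁ : 1 ≤ c₁) (h₂ : 1 ≤ c₂) (h₃ : 1 ≤ c₃) (h₄ : 1 ≤ c₄)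
    (h₅ : 1 ≤ c₅) (h₆ : 1 ≤ c₆) (h₇ : 1 ≤ c₇) (h₇₄ : c₇ ≤ c₄) :
    ∀ v : (Fin c₁ ⊕ Fin c₃ ⊕ Fin c₅) × (Fin c₂ ⊕ Fin c₄ ⊕ Fin c₆),
      v ∈ diag3 (Fin c₁) (Fin c₃) (Fin c₅) (Fin c₂) (Fin c₄) (Fin c₆) ↔
        ((∃ a₁ a₂, v = (Sum.inl a₁, Sum.inl a₂)) ∨
         ∃ u, (∃ a₁ a₂, u = (Sum.inl a₁, Sum.inl a₂)) ∧
           Relation.ReflTransGen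
             ((Qrow c₁ c₃ c₅).tensor (Qcol c₂ c₄ c₆ c₇)).Adj u v) := by
  have mid_adj : ∀ b₁ b₂, ((Qrow c₁ c₃ c₅).tensor (Qcol c₂ c₄ c₆ c₇)).Adj
      (Sum.inl ⟨0, h₁⟩, Sum.inl ⟨0, h₂⟩) (Sum.inr (Sum.inl b₁), Sum.inr (Sum.inl b₂)) :=
    fun b₁ b₂ => ⟨Or.inl ⟨⟨_, rfl⟩, ⟨b₁, rfl⟩⟩, Or.inl ⟨⟨_, rfl⟩, ⟨b₂, rfl⟩⟩⟩
  intro v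
  constructor
  · rintro (h | ⟨b₁, b₂, rfl⟩ | ⟨d₁, d₂, rfl⟩)
    · exact Or.inl h
    · exact Or.inr ⟨_, ⟨_, _, rfl⟩, .single (mid_adj b₁ b₂)⟩
    · exact Or.inr ⟨_, ⟨_, _, rfl⟩, (Relation.ReflTransGen.single
        (mid_adj ⟨0, h₃⟩ ⟨0, h₄⟩)).tail
          ⟨Or.inr ⟨⟨_, rfl, trivial⟩, ⟨d₁, rfl⟩⟩, Or.inr ⟨⟨_, rfl, h₇⟩, ⟨d₂, rfl⟩⟩⟩⟩
  · rintro (h | ⟨u, hu, huv⟩)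
    · exact Or.inl h
    · induction huv with
      | refl => exact Or.inl hu
      | tail _ hadj ih => exact diag3_of_tensor_threeLayer_adj ih hadj
end
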